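/- Convex-geometric properties of the sublevel sets: for every c ∈ ℝ₊ the sublevel set S = L_c^−(𝓡_{α,β}) = { μ ∈ 𝒜 : 𝓡_{α,β}(μ) ≤ c }, regarded as a convex subset of L²_w(I;ℳ(Ω)), is linearly closed (its intersection with every one-dimensional affine subspace is closed), contains no rays { μ + t ν : t > 0 } with ν ≠ 0, and has trivial lineality space lin(S) = rec(S) ∩ (−rec(S)) = {0}. -/

import Mathlib

open MeasureTheory Filter Topology Set
open scoped ENNReal NNReal RealInnerProductSpace

noncomputable section

/-- The unit time interval `[0,1] ⊆ ℝ`. -/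
def unitI : Set ℝ := Set.Icc 0 1

/-- Lebesgue measure restricted to the unit interval. -/
def lebI : Measure ℝ := volume.restrict unitI

/-- The (pointwise) variation of a curve `f : ℝ → X` on a set `s ⊆ ℝ`,
with respect to a distance function `d`. -/
def varOn {X : Type*} (d : X → X → ℝ≥0∞) (f : ℝ → X) (s : Set ℝ) : ℝ≥0∞ :=
  ⨆ p : ℕ × { u : ℕ → ℝ // Monotone u ∧ ∀ i, u i ∈ s },
    ∑ i ∈ Finset.range p.1, d (f (p.2.1 (i + 1))) (f (p.2.1 i))

/-- The essential variation of `f` on `s`: infimum of variations over a.e. representatives. -/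
def essVarOn {X : Type*} (d : X → X → ℝ≥0∞) (f : ℝ → X) (s : Set ℝ) : ℝ≥0∞ :=
  ⨅ g ∈ {g : ℝ → X | ∀ᵐ t ∂(volume.restrict s), g t = f t}, varOn d g s

/-- Essential variation on the unit interval. -/
def essVar {X : Type*} (d : X → X → ℝ≥0∞) (f : ℝ → X) : ℝ≥0∞ := essVarOn d f unitI

/-- Couplings (transport plans) between two measures. -/
def IsCoupling {X : Type*} [MeasurableSpace X] (ρp ρm : Measure X)
    (π : Measure (X × X)) : Prop :=
  π.map Prod.fst = ρp ∧ π.map Prod.snd = ρm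

/-- The Wasserstein-1 distance between measures. -/
def W1 {X : Type*} [MeasurableSpace X] [PseudoEMetricSpace X]
    (ρp ρm : Measure X) : ℝ≥0∞ :=
  ⨅ π ∈ {π : Measure (X × X) | IsCoupling ρp ρm π}, ∫⁻ q, edist q.1 q.2 ∂π

/-- `W1` as a distance function on measures. -/
def W1M {X : Type*} [MeasurableSpace X] [PseudoEMetricSpace X] :
    Measure X → Measure X → ℝ≥0∞ := fun a b => W1 a b

/-- Wasserstein-1 distance on probability measures. -/
def W1P {X : Type*} [MeasurableSpace X] [PseudoEMetricSpace X] :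
    ProbabilityMeasure X → ProbabilityMeasure X → ℝ≥0∞ :=
  fun a b => W1 (a : Measure X) (b : Measure X)

/-- The admissible set `𝒜 = ℝ₊ ⬝ BV(I; 𝒲₁(Ω))` of weighted BV curves of probability measures. -/
def Adm {n : ℕ} (Ω : Set (EuclideanSpace ℝ (Fin n))) : Set (ℝ → Measure ↥Ω) :=
  {μ | ∃ (c : ℝ≥0) (ρ : ℝ → ProbabilityMeasure ↥Ω),
      essVar W1P ρ < ⊤ ∧ ∀ t, μ t = (c : ℝ≥0∞) • (ρ t : Measure ↥Ω)}

/-- The weight `ω(μ)` of an admissible curve. -/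
def wt {n : ℕ} {Ω : Set (EuclideanSpace ℝ (Fin n))} (μ : ℝ → Measure ↥Ω) : ℝ :=
  (μ 0 Set.univ).toReal

/-- The regularizer `𝓡_{α,β}(μ) = α ω(μ) + β essvar(μ)`. -/
def Reg {n : ℕ} {Ω : Set (EuclideanSpace ℝ (Fin n))} (α β : ℝ)
    (μ : ℝ → Measure ↥Ω) : ℝ :=
  α * wt μ + β * (essVar W1M μ).toReal

/-- Weak-* convergence of a sequence of measures (tested against continuous functions). -/
def WStarTendsto {X : Type*} [MeasurableSpace X] [TopologicalSpace X]
    (μs : ℕ → Measure X) (μ : Measure X) : Prop :=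
  ∀ φ : C(X, ℝ), Tendsto (fun j => ∫ x, φ x ∂(μs j)) atTop (𝓝 (∫ x, φ x ∂μ))

/-- A.e. (in time) weak-* convergence of curves of measures. -/
def AEWStar {n : ℕ} {Ω : Set (EuclideanSpace ℝ (Fin n))}
    (μs : ℕ → (ℝ → Measure ↥Ω)) (μ : ℝ → Measure ↥Ω) : Prop :=
  ∀ᵐ t ∂lebI, WStarTendsto (fun j => μs j t) (μ t)

/-- Weak convergence in a real inner product space. -/
def WeakTendsto {Y : Type*} [NormedAddCommGroup Y] [InnerProductSpace ℝ Y]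
    (ys : ℕ → Y) (y : Y) : Prop :=
  ∀ z : Y, Tendsto (fun j => @inner ℝ Y _ (ys j) z) atTop (𝓝 (@inner ℝ Y _ y z))


/-- The canonical embedding of a curve of measures into the vector space of (time-indexed)
functionals on `C(Ω)`, realizing `𝒜` as a subset of the vector space containing
`L²_w(I;ℳ(Ω))`. -/
def toFunc {n : ℕ} {Ω : Set (EuclideanSpace ℝ (Fin n))} (μ : ℝ → Measure ↥Ω) :
    ℝ → C(↥Ω, ℝ) → ℝ :=
  fun t φ => ∫ x, φ x ∂(μ t)

/-- Weak-* convergence of a family of measures along a filter. -/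
def WStarTendstoAlong {ι X : Type*} [MeasurableSpace X] [TopologicalSpace X]
    (U : Filter ι) (m : ι → Measure X) (m' : Measure X) : Prop :=
  ∀ φ : C(X, ℝ), Tendsto (fun k => ∫ x, φ x ∂(m k)) U (𝓝 (∫ x, φ x ∂m'))

section Transport

variable {ι X : Type*} [MeasurableSpace X]

/-- Finite measures are determined by integrals of continuous functions. -/
lemma measure_ext_of_integral_continuousMap [TopologicalSpace X] [HasOuterApproxClosed X]
    [BorelSpace X] {μ ν : Measure X} [IsFiniteMeasure μ] [IsFiniteMeasure ν]
    (h : ∀ φ : C(X, ℝ), ∫ x, φ x ∂μ = ∫ x, φ x ∂ν) : μ = ν :=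
  ext_of_forall_integral_eq_of_IsFiniteMeasure fun f => h f.toContinuousMap

/-- Measures of bounded mass on a compact space converge weakly-* along any ultrafilter. -/
lemma exists_wStarTendstoAlong [TopologicalSpace X] [T2Space X] [CompactSpace X] [BorelSpace X]
    (U : Ultrafilter ι) (m : ι → Measure X) (C : ℝ≥0) (hm : ∀ k, m k univ ≤ C) :
    ∃ m' : Measure X, IsFiniteMeasure m' ∧ WStarTendstoAlong (U : Filter ι) m m' := by
  have hfin : ∀ k, IsFiniteMeasure (m k) := fun k => ⟨(hm k).trans_lt ENNReal.coe_lt_top⟩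
  let F : ι → FiniteMeasure X := fun k => ⟨m k, hfin k⟩
  obtain ⟨x, -, hx⟩ :=
    (isCompact_setOfPred_finiteMeasure_le_of_compactSpace X C).ultrafilter_le_nhds' (U.map F) (by
      refine Filter.mem_map.2 (Filter.univ_mem' fun k => ?_)
      have : ((F k).mass : ℝ≥0∞) ≤ C := by
        rw [FiniteMeasure.ennreal_mass]
        exact hm k
      exact_mod_cast this)
  refine ⟨x, inferInstance, fun φ => ?_⟩
  have hx' : Tendsto F U (𝓝 x) := hx
  exact FiniteMeasure.tendsto_iff_forall_integral_tendsto.1 hx'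
    (BoundedContinuousFunction.mkOfCompact φ)

lemma IsCoupling.measure_univ_eq {a b : Measure X} {π : Measure (X × X)} (h : IsCoupling a b π) :
    π univ = a univ ∧ π univ = b univ := by
  rw [← h.1, ← h.2, Measure.map_apply measurable_fst MeasurableSet.univ,
    Measure.map_apply measurable_snd MeasurableSet.univ]
  simp

lemma exists_coupling_of_W1_lt [PseudoEMetricSpace X] {a b : Measure X} {e : ℝ≥0∞}
    (h : W1 a b < e) : ∃ π, IsCoupling a b π ∧ ∫⁻ q, edist q.1 q.2 ∂π < e := by
  simpa [W1, iInf_lt_iff] using h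

/-- Measures at finite Wasserstein distance have the same mass. -/
lemma measure_univ_eq_of_W1_lt_top [PseudoEMetricSpace X] {a b : Measure X}
    (h : W1 a b < ⊤) : a univ = b univ := by
  obtain ⟨π, hπ, -⟩ := exists_coupling_of_W1_lt h
  exact hπ.measure_univ_eq.1.symm.trans hπ.measure_univ_eq.2

lemma W1_smul_le [PseudoEMetricSpace X] (r : ℝ≥0) (a b : Measure X) :
    W1 ((r : ℝ≥0∞) • a) ((r : ℝ≥0∞) • b) ≤ r * W1 a b := by
  rcases eq_or_ne r 0 with rfl | hr
  · refine (iInf₂_le (0 : Measure (X × X)) ?_).trans ?_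
    · simp [IsCoupling]
    · simp
  · have hr' : (r : ℝ≥0∞) ≠ 0 := by simpa using hr
    simp only [W1]
    rw [ENNReal.mul_iInf_of_ne hr' ENNReal.coe_ne_top]
    refine le_iInf fun π => ?_
    rw [ENNReal.mul_iInf_of_ne hr' ENNReal.coe_ne_top]
    refine le_iInf fun hπ => ?_
    refine (iInf₂_le ((r : ℝ≥0∞) • π) ?_).trans ?_
    · exact ⟨by rw [Measure.map_smul, hπ.1], by rw [Measure.map_smul, hπ.2]⟩
    · rw [lintegral_smul_measure, smul_eq_mul]

/-- Lower semicontinuity of the Wasserstein distance under weak-* convergence. -/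
lemma W1_le_of_wStarTendstoAlong [MetricSpace X] [CompactSpace X] [BorelSpace X]
    (U : Ultrafilter ℕ) (hU : (U : Filter ℕ) ≤ atTop) {a b : ℕ → Measure X} {a' b' : Measure X}
    [IsFiniteMeasure a'] [IsFiniteMeasure b'] (C : ℝ≥0) (hC : ∀ k, a k univ ≤ C)
    (ha : WStarTendstoAlong (U : Filter ℕ) a a') (hb : WStarTendstoAlong (U : Filter ℕ) b b')
    (hfin : ∀ k, W1 (a k) (b k) < ⊤) {L : ℝ≥0∞}
    (hL : Tendsto (fun k => W1 (a k) (b k)) (U : Filter ℕ) (𝓝 L)) : W1 a' b' ≤ L := by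
  have hlt : ∀ k : ℕ, W1 (a k) (b k) < W1 (a k) (b k) + ((k : ℝ≥0∞) + 1)⁻¹ := fun k =>
    ENNReal.lt_add_right (hfin k).ne (by simp [ENNReal.add_eq_top])
  choose π hπ hcost using fun k => exists_coupling_of_W1_lt (hlt k)
  have hmass : ∀ k, π k univ ≤ C := fun k => (hπ k).measure_univ_eq.1.trans_le (hC k)
  have hπfin : ∀ k, IsFiniteMeasure (π k) := fun k => ⟨(hmass k).trans_lt ENNReal.coe_lt_top⟩
  obtain ⟨π', hπ', hlim⟩ := exists_wStarTendstoAlong U π C hmass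
  have hcoupling : IsCoupling a' b' π' := by
    constructor
    · refine measure_ext_of_integral_continuousMap fun φ => ?_
      rw [integral_map measurable_fst.aemeasurable φ.continuous.aestronglyMeasurable]
      refine tendsto_nhds_unique (hlim (φ.comp ContinuousMap.fst)) ((ha φ).congr fun k => ?_)
      rw [← (hπ k).1, integral_map measurable_fst.aemeasurable φ.continuous.aestronglyMeasurable]
      rfl
    · refine measure_ext_of_integral_continuousMap fun φ => ?_
      rw [integral_map measurable_snd.aemeasurable φ.continuous.aestronglyMeasurable]
      refine tendsto_nhds_unique (hlim (φ.comp ContinuousMap.snd)) ((hb φ).congr fun k => ?_)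
      rw [← (hπ k).2, integral_map measurable_snd.aemeasurable φ.continuous.aestronglyMeasurable]
      rfl
  let D : C(X × X, ℝ) := ⟨fun q => dist q.1 q.2, continuous_dist⟩
  have hD : ∀ p : Measure (X × X), IsFiniteMeasure p →
      ∫⁻ q, edist q.1 q.2 ∂p = ENNReal.ofReal (∫ q, D q ∂p) := by
    intro p _
    have hint : Integrable D p := (BoundedContinuousFunction.mkOfCompact D).integrable p
    rw [ofReal_integral_eq_lintegral_ofReal hint (ae_of_all _ fun q => dist_nonneg)]
    exact lintegral_congr fun q => edist_dist _ _
  refine (iInf₂_le π' hcoupling).trans ?_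
  rw [hD π' hπ']
  have hzero : Tendsto (fun k : ℕ => ((k : ℝ≥0∞) + 1)⁻¹) (U : Filter ℕ) (𝓝 0) := by
    refine Tendsto.mono_left ?_ hU
    simpa using (tendsto_add_atTop_iff_nat 1).2 ENNReal.tendsto_inv_nat_nhds_zero
  have hsum := hL.add hzero
  rw [add_zero] at hsum
  refine le_of_tendsto_of_tendsto' (ENNReal.tendsto_ofReal (hlim D)) hsum fun k => ?_
  rw [← hD (π k) (hπfin k)]
  exact (hcost k).le

end Transport

section Variation

variable {X Y : Type*}

lemma sum_le_varOn (d : X → X → ℝ≥0∞) (f : ℝ → X) {s : Set ℝ} (N : ℕ) {u : ℕ → ℝ}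
    (hu : Monotone u) (hus : ∀ i, u i ∈ s) :
    ∑ i ∈ Finset.range N, d (f (u (i + 1))) (f (u i)) ≤ varOn d f s :=
  le_iSup (fun p : ℕ × { u : ℕ → ℝ // Monotone u ∧ ∀ i, u i ∈ s } =>
    ∑ i ∈ Finset.range p.1, d (f (p.2.1 (i + 1))) (f (p.2.1 i))) (N, ⟨u, hu, hus⟩)

lemma le_varOn (d : X → X → ℝ≥0∞) (f : ℝ → X) {s : Set ℝ} {x y : ℝ} (hxy : x ≤ y)
    (hx : x ∈ s) (hy : y ∈ s) : d (f y) (f x) ≤ varOn d f s := by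
  have hu : Monotone (fun i : ℕ => if i = 0 then x else y) := by
    refine monotone_nat_of_le_succ fun i => ?_
    rcases eq_or_ne i 0 with h | h <;> simp [h, hxy]
  have := sum_le_varOn d f 1 hu (s := s) (fun i => by by_cases h : i = 0 <;> simp [h, hx, hy])
  simpa using this

lemma varOn_le_mul {d : X → X → ℝ≥0∞} {d' : Y → Y → ℝ≥0∞} {f : ℝ → X} {f' : ℝ → Y} {s : Set ℝ}
    (r : ℝ≥0∞) (h : ∀ x ∈ s, ∀ y ∈ s, d (f x) (f y) ≤ r * d' (f' x) (f' y)) :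
    varOn d f s ≤ r * varOn d' f' s := by
  refine iSup_le fun p => ?_
  refine le_trans ?_ (mul_le_mul_right (sum_le_varOn d' f' p.1 p.2.2.1 p.2.2.2) r)
  rw [Finset.mul_sum]
  exact Finset.sum_le_sum fun i _ => h _ (p.2.2.2 _) _ (p.2.2.2 _)

lemma essVar_le_varOn {d : X → X → ℝ≥0∞} {f g : ℝ → X}
    (h : ∀ᵐ t ∂(volume.restrict unitI), g t = f t) : essVar d f ≤ varOn d g unitI :=
  iInf₂_le g h

lemma exists_varOn_lt_of_essVar_lt {d : X → X → ℝ≥0∞} {f : ℝ → X} {e : ℝ≥0∞}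
    (h : essVar d f < e) :
    ∃ g : ℝ → X, (∀ᵐ t ∂(volume.restrict unitI), g t = f t) ∧ varOn d g unitI < e := by
  simpa [essVar, essVarOn, iInf_lt_iff] using h

/-- A curve of measures of constant mass has near-optimal representatives of the same mass. -/
lemma exists_representative_of_essVar_lt [MeasurableSpace X] [PseudoEMetricSpace X]
    {μ : ℝ → Measure X} {m e : ℝ≥0∞} (hm : ∀ s, μ s univ = m) (h : essVar W1M μ < e) :
    ∃ g : ℝ → Measure X, (∀ s, g s univ = m) ∧
      (∀ᵐ t ∂(volume.restrict unitI), g t = μ t) ∧ varOn W1M g unitI < e := by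
  obtain ⟨g, hae, hvar⟩ := exists_varOn_lt_of_essVar_lt h
  classical
  have hI : MeasurableSet unitI := measurableSet_Icc
  have : NeBot (ae (volume.restrict unitI)) := by
    rw [ae_neBot, Ne, Measure.restrict_eq_zero]
    simp [unitI]
  obtain ⟨s₀, hs₀, hs₀I⟩ := (hae.and (ae_restrict_mem hI)).exists
  have hmass : ∀ s ∈ unitI, g s univ = m := by
    intro s hs
    rw [← hm s₀, ← hs₀]
    rcases le_total s s₀ with hle | hle
    · exact (measure_univ_eq_of_W1_lt_top
        (((le_varOn W1M g hle hs hs₀I).trans_lt hvar).trans_le le_top)).symm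
    · exact measure_univ_eq_of_W1_lt_top
        (((le_varOn W1M g hle hs₀I hs).trans_lt hvar).trans_le le_top)
  refine ⟨unitI.piecewise g μ, fun s => ?_, ?_, ?_⟩
  · by_cases hs : s ∈ unitI
    · rw [Set.piecewise_eq_of_mem _ _ _ hs, hmass s hs]
    · rw [Set.piecewise_eq_of_notMem _ _ _ hs, hm s]
  · filter_upwards [hae, ae_restrict_mem hI] with t ht htI
    rw [Set.piecewise_eq_of_mem _ _ _ htI, ht]
  · refine lt_of_le_of_lt ?_ hvar
    rw [← one_mul (varOn W1M g unitI)]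
    refine varOn_le_mul 1 fun x hx y hy => ?_
    rw [Set.piecewise_eq_of_mem _ _ _ hx, Set.piecewise_eq_of_mem _ _ _ hy, one_mul]

/-- Lower semicontinuity of the variation under pointwise weak-* convergence. -/
lemma varOn_le_of_wStarTendstoAlong [MeasurableSpace X] [MetricSpace X] [CompactSpace X]
    [BorelSpace X] (U : Ultrafilter ℕ) (hU : (U : Filter ℕ) ≤ atTop)
    {g : ℕ → ℝ → Measure X} {g' : ℝ → Measure X} (hg' : ∀ s, IsFiniteMeasure (g' s)) (C : ℝ≥0)
    (hC : ∀ k s, g k s univ ≤ C)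
    (hlim : ∀ s, WStarTendstoAlong (U : Filter ℕ) (fun k => g k s) (g' s)) {s : Set ℝ}
    {e : ℕ → ℝ≥0∞} {e' : ℝ≥0∞} (he : Tendsto e (U : Filter ℕ) (𝓝 e')) (hfin : ∀ k, e k < ⊤)
    (hvar : ∀ k, varOn W1M (g k) s ≤ e k) : varOn W1M g' s ≤ e' := by
  refine iSup_le fun ⟨N, u, hu, hus⟩ => ?_
  have hex : ∀ i, ∃ L, Tendsto (fun k => W1 (g k (u (i + 1))) (g k (u i))) (U : Filter ℕ) (𝓝 L) :=
    fun i => by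
      obtain ⟨L, -, hL⟩ := isCompact_univ.ultrafilter_le_nhds'
        (U.map fun k => W1 (g k (u (i + 1))) (g k (u i))) univ_mem
      exact ⟨L, hL⟩
  choose L hL using hex
  calc ∑ i ∈ Finset.range N, W1M (g' (u (i + 1))) (g' (u i))
      ≤ ∑ i ∈ Finset.range N, L i := Finset.sum_le_sum fun i _ =>
        W1_le_of_wStarTendstoAlong U hU C (fun k => hC k _) (hlim _) (hlim _)
          (fun k => (le_varOn W1M (g k) (hu i.le_succ) (hus _) (hus _)).trans_lt
            ((hvar k).trans_lt (hfin k))) (hL i)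
    _ ≤ e' := le_of_tendsto_of_tendsto' (tendsto_finsetSum _ fun i _ => hL i) he fun k =>
        (sum_le_varOn W1M (g k) N hu hus).trans (hvar k)

end Variation

section Sublevel

variable {n : ℕ} {Ω : Set (EuclideanSpace ℝ (Fin n))}

/-- Admissible curves are the curves of constant mass and finite essential variation. -/
lemma mem_Adm_iff (hΩne : Ω.Nonempty) {μ : ℝ → Measure ↥Ω} :
    μ ∈ Adm Ω ↔ ∃ m : ℝ≥0, (∀ s, μ s univ = m) ∧ essVar W1M μ < ⊤ := by
  constructor
  · rintro ⟨m, ρ, hρ, hμ⟩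
    refine ⟨m, fun s => by simp [hμ s], ?_⟩
    obtain ⟨g, hae, hvar⟩ := exists_varOn_lt_of_essVar_lt hρ
    refine (essVar_le_varOn (g := fun s => (m : ℝ≥0∞) • (g s : Measure ↥Ω)) ?_).trans_lt
      ((varOn_le_mul (d' := W1P) (f' := g) (m : ℝ≥0∞) fun x _ y _ => W1_smul_le m _ _).trans_lt
        (ENNReal.mul_lt_top ENNReal.coe_lt_top hvar))
    filter_upwards [hae] with t ht
    rw [ht, hμ t]
  · rintro ⟨m, hm, hvar⟩
    rcases eq_or_ne m 0 with rfl | hm0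
    · obtain ⟨x, hx⟩ := hΩne
      let δ : ProbabilityMeasure ↥Ω := ⟨Measure.dirac ⟨x, hx⟩, inferInstance⟩
      have hμ0 : ∀ s, μ s = 0 := fun s => by simpa using hm s
      have hself : W1P δ δ ≤ 0 := by
        refine (iInf₂_le (Measure.dirac ((⟨x, hx⟩, ⟨x, hx⟩) : ↥Ω × ↥Ω)) ?_).trans ?_
        · exact ⟨Measure.map_dirac' measurable_fst _, Measure.map_dirac' measurable_snd _⟩
        · rw [lintegral_dirac]
          simp
      refine ⟨0, fun _ => δ, ?_, fun s => by simp [hμ0 s]⟩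
      refine (essVar_le_varOn (g := fun _ => δ) (ae_of_all _ fun _ => rfl)).trans_lt ?_
      refine (iSup_le fun p => ?_ : _ ≤ (0 : ℝ≥0∞)).trans_lt ENNReal.zero_lt_top
      simpa using Or.inr hself
    · obtain ⟨g, hg, hae, hgvar⟩ := exists_representative_of_essVar_lt hm hvar
      have hprob : ∀ p : Measure ↥Ω, p univ = m →
          IsProbabilityMeasure (((m⁻¹ : ℝ≥0) : ℝ≥0∞) • p) := fun p hp =>
        ⟨by rw [Measure.smul_apply, hp, smul_eq_mul, ← ENNReal.coe_mul, inv_mul_cancel₀ hm0,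
          ENNReal.coe_one]⟩
      let ρ : ℝ → ProbabilityMeasure ↥Ω := fun s => ⟨_, hprob (μ s) (hm s)⟩
      let h : ℝ → ProbabilityMeasure ↥Ω := fun s => ⟨_, hprob (g s) (hg s)⟩
      have hh : ∀ᵐ t ∂(volume.restrict unitI), h t = ρ t := by
        filter_upwards [hae] with t ht
        exact Subtype.ext (congrArg (fun p : Measure ↥Ω => ((m⁻¹ : ℝ≥0) : ℝ≥0∞) • p) ht)
      have hle : varOn W1P h unitI ≤ ((m⁻¹ : ℝ≥0) : ℝ≥0∞) * varOn W1M g unitI :=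
        varOn_le_mul _ fun x _ y _ => W1_smul_le m⁻¹ (g x) (g y)
      refine ⟨m, ρ, (essVar_le_varOn hh).trans_lt
        (hle.trans_lt (ENNReal.mul_lt_top ENNReal.coe_lt_top hgvar)), fun s => ?_⟩
      change μ s = (m : ℝ≥0∞) • (((m⁻¹ : ℝ≥0) : ℝ≥0∞) • μ s)
      rw [smul_smul, ← ENNReal.coe_mul, mul_inv_cancel₀ hm0, ENNReal.coe_one, one_smul]

/-- Sublevel sets of the regularizer are closed under pointwise weak-* limits. -/
lemma mem_image_sublevel_of_tendsto (hΩne : Ω.Nonempty) (hΩcp : IsCompact Ω)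
    {α β c : ℝ} (hα : 0 < α) (hβ : 0 < β) {μ : ℕ → ℝ → Measure ↥Ω}
    (hμ : ∀ k, μ k ∈ Adm Ω) (hreg : ∀ k, Reg α β (μ k) ≤ c) {F : ℝ → C(↥Ω, ℝ) → ℝ}
    (hF : ∀ s φ, Tendsto (fun k => toFunc (μ k) s φ) atTop (𝓝 (F s φ))) :
    F ∈ toFunc '' {μ ∈ Adm Ω | Reg α β μ ≤ c} := by
  have : CompactSpace ↥Ω := isCompact_iff_compactSpace.1 hΩcp
  let U : Ultrafilter ℕ := hyperfilter ℕ
  have hU : (U : Filter ℕ) ≤ atTop := Nat.hyperfilter_le_atTop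
  choose m hm hvar using fun k => (mem_Adm_iff hΩne).1 (hμ k)
  have hwt : ∀ k, wt (μ k) = m k := fun k => by simp [wt, hm k]
  have hess : ∀ k, (essVar W1M (μ k)).toReal ≤ (c - α * m k) / β := fun k => by
    have := hreg k
    rw [Reg, hwt] at this
    rw [le_div_iff₀ hβ]
    linarith
  have hmC : ∀ k, m k ≤ (c / α).toNNReal := fun k => by
    refine NNReal.le_toNNReal_of_coe_le ?_
    have h0 := ENNReal.toReal_nonneg.trans (hess k)
    rw [le_div_iff₀ hβ, zero_mul] at h0
    rw [le_div_iff₀ hα]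
    linarith
  have hmass : ∀ k s, μ k s univ ≤ ((c / α).toNNReal : ℝ≥0∞) := fun k s => by
    rw [hm k s]
    exact_mod_cast hmC k
  choose ν hνfin hν using fun s => exists_wStarTendstoAlong U (fun k => μ k s) _ (hmass · s)
  have hνF : toFunc ν = F := by
    ext s φ
    exact tendsto_nhds_unique (hν s φ) ((hF s φ).mono_left hU)
  have hmlim : ∀ s, Tendsto (fun k => (m k : ℝ)) U (𝓝 ((ν s univ).toReal)) := fun s => by
    have := hν s 1
    simpa [Measure.real, hm] using this
  have hνmass : ∀ s, ν s univ = ((ν 0 univ).toNNReal : ℝ≥0∞) := fun s => by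
    rw [ENNReal.coe_toNNReal (measure_ne_top _ _),
      ← ENNReal.toReal_eq_toReal_iff' (measure_ne_top _ _) (measure_ne_top _ _)]
    exact tendsto_nhds_unique (hmlim s) (hmlim 0)
  have hlt : ∀ k, essVar W1M (μ k) <
      ENNReal.ofReal ((c - α * m k) / β) + ((k : ℝ≥0∞) + 1)⁻¹ := fun k =>
    (ENNReal.le_ofReal_iff_toReal_le (hvar k).ne (ENNReal.toReal_nonneg.trans (hess k))).2
      (hess k) |>.trans_lt (ENNReal.lt_add_right ENNReal.ofReal_ne_top
        (by simp [ENNReal.add_eq_top]))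
  choose g hg hgae hgvar using fun k => exists_representative_of_essVar_lt (hm k) (hlt k)
  have hgC : ∀ k s, g k s univ ≤ ((c / α).toNNReal : ℝ≥0∞) := fun k s => by
    rw [hg k s]
    exact_mod_cast hmC k
  choose g' hg'fin hg' using fun s => exists_wStarTendstoAlong U (fun k => g k s) _ (hgC · s)
  have hae : ∀ᵐ t ∂(volume.restrict unitI), g' t = ν t := by
    filter_upwards [ae_all_iff.2 hgae] with t ht
    refine measure_ext_of_integral_continuousMap fun φ => ?_
    refine tendsto_nhds_unique (hg' t φ) ((hν t φ).congr fun k => ?_)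
    simp only [ht k]
  have hlimreal : Tendsto (fun k => (c - α * m k) / β) U
      (𝓝 ((c - α * (ν 0 univ).toReal) / β)) :=
    (tendsto_const_nhds.sub ((hmlim 0).const_mul α)).div_const β
  have hzero : Tendsto (fun k : ℕ => ((k : ℝ≥0∞) + 1)⁻¹) (U : Filter ℕ) (𝓝 0) := by
    refine Tendsto.mono_left ?_ hU
    simpa using (tendsto_add_atTop_iff_nat 1).2 ENNReal.tendsto_inv_nat_nhds_zero
  have hlim := (ENNReal.tendsto_ofReal hlimreal).add hzero
  rw [add_zero] at hlim
  have hνvar : essVar W1M ν ≤ ENNReal.ofReal ((c - α * (ν 0 univ).toReal) / β) :=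
    (essVar_le_varOn hae).trans (varOn_le_of_wStarTendstoAlong U hU hg'fin _ hgC hg' hlim
      (fun k => ENNReal.add_lt_top.2 ⟨ENNReal.ofReal_lt_top, by simp⟩) fun k => (hgvar k).le)
  refine ⟨ν, ⟨(mem_Adm_iff hΩne).2 ⟨_, hνmass, hνvar.trans_lt ENNReal.ofReal_lt_top⟩, ?_⟩, hνF⟩
  have hnonneg : 0 ≤ (c - α * (ν 0 univ).toReal) / β :=
    ge_of_tendsto' hlimreal fun k => ENNReal.toReal_nonneg.trans (hess k)
  have := ENNReal.toReal_le_of_le_ofReal hnonneg hνvar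
  rw [le_div_iff₀ hβ] at this
  rw [Reg, wt]
  linarith

lemma zero_mem_image_sublevel (hΩne : Ω.Nonempty) {α β c : ℝ} (hc : 0 ≤ c) :
    (0 : ℝ → C(↥Ω, ℝ) → ℝ) ∈ toFunc '' {μ ∈ Adm Ω | Reg α β μ ≤ c} := by
  have hvar : essVar W1M (fun _ => (0 : Measure ↥Ω)) = 0 := by
    refine le_antisymm ((essVar_le_varOn (ae_of_all _ fun _ => rfl)).trans
      (iSup_le fun p => ?_)) zero_le
    have : W1M (0 : Measure ↥Ω) 0 = 0 := by simpa [W1M] using W1_smul_le 0 (0 : Measure ↥Ω) 0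
    simp [this]
  refine ⟨fun _ => 0, ⟨(mem_Adm_iff hΩne).2 ⟨0, by simp, by simp [hvar]⟩, ?_⟩, ?_⟩
  · simpa [Reg, wt, hvar] using hc
  · ext s φ
    simp [toFunc]

/-- Elements of a sublevel set are bounded functionals, uniformly in time. -/
lemma abs_le_of_mem_image_sublevel (hΩne : Ω.Nonempty) (hΩcp : IsCompact Ω) {α β c : ℝ}
    (hα : 0 < α) (hβ : 0 < β) (φ : C(↥Ω, ℝ)) :
    ∃ B : ℝ, ∀ F ∈ toFunc '' {μ ∈ Adm Ω | Reg α β μ ≤ c}, ∀ s, |F s φ| ≤ B := by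
  have : CompactSpace ↥Ω := isCompact_iff_compactSpace.1 hΩcp
  refine ⟨‖φ‖ * (c / α), ?_⟩
  rintro _ ⟨μ, ⟨hμ, hreg⟩, rfl⟩ s
  obtain ⟨m, hm, -⟩ := (mem_Adm_iff hΩne).1 hμ
  have : IsFiniteMeasure (μ s) := ⟨by simp [hm s]⟩
  have hbound : ‖∫ x, φ x ∂(μ s)‖ ≤ ‖φ‖ * (μ s).real univ :=
    norm_integral_le_of_norm_le_const (ae_of_all _ fun x => φ.norm_coe_le_norm x)
  refine hbound.trans (mul_le_mul_of_nonneg_left ?_ (norm_nonneg φ))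
  have h0 : 0 ≤ β * (essVar W1M μ).toReal := mul_nonneg hβ.le ENNReal.toReal_nonneg
  have hreg' : α * wt μ + β * (essVar W1M μ).toReal ≤ c := hreg
  have hw : wt μ = (μ s).real univ := by rw [wt, Measure.real, hm 0, hm s]
  rw [hw] at hreg'
  rw [le_div_iff₀ hα]
  linarith

lemma direction_eq_zero_of_ray_subset (hΩne : Ω.Nonempty) (hΩcp : IsCompact Ω) {α β c : ℝ}
    (hα : 0 < α) (hβ : 0 < β) {v w : ℝ → C(↥Ω, ℝ) → ℝ}
    (h : ∀ t : ℝ, 0 < t → v + t • w ∈ toFunc '' {μ ∈ Adm Ω | Reg α β μ ≤ c}) : w = 0 := by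
  ext s φ
  obtain ⟨B, hB⟩ := abs_le_of_mem_image_sublevel hΩne hΩcp (c := c) hα hβ φ
  by_contra hw
  have hpos : 0 < |w s φ| := abs_pos.2 hw
  have hBv : 0 ≤ B + |v s φ| :=
    add_nonneg ((abs_nonneg _).trans (hB _ (h 1 one_pos) s)) (abs_nonneg _)
  set t : ℝ := (B + |v s φ| + 1) / |w s φ| with ht
  have htpos : 0 < t := div_pos (by linarith) hpos
  have hle : |v s φ + t * w s φ| ≤ B := hB _ (h t htpos) s
  have htri : |t * w s φ| ≤ |v s φ + t * w s φ| + |v s φ| := by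
    simpa using abs_sub (v s φ + t * w s φ) (v s φ)
  rw [abs_mul, abs_of_pos htpos, ht, div_mul_cancel₀ _ hpos.ne'] at htri
  rw [← ht] at htri
  linarith

end Sublevel

/-- Convex-geometric properties of the sublevel sets of the regularizer:
each sublevel set `S = L_c⁻(𝓡_{α,β})`, regarded (via the duality embedding) as a convex
subset of the vector space containing `L²_w(I;ℳ(Ω))`, is linearly closed, contains no rays,
and has trivial lineality space. -/
theorem sublevel_linearly_closed_no_rays_trivial_lineality
    {n : ℕ} (Ω : Set (EuclideanSpace ℝ (Fin n)))
    (hΩne : Ω.Nonempty) (hΩcp : IsCompact Ω) (hΩcv : Convex ℝ Ω)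
    (α β : ℝ) (hα : 0 < α) (hβ : 0 < β) (c : ℝ) (hc : 0 ≤ c) :
    letI S : Set (ℝ → C(↥Ω, ℝ) → ℝ) := toFunc '' {μ ∈ Adm Ω | Reg α β μ ≤ c}
    (∀ v w : ℝ → C(↥Ω, ℝ) → ℝ, IsClosed {t : ℝ | v + t • w ∈ S}) ∧
    (¬ ∃ (v w : ℝ → C(↥Ω, ℝ) → ℝ), w ≠ 0 ∧ ∀ t : ℝ, 0 < t → v + t • w ∈ S) ∧
    (∀ w : ℝ → C(↥Ω, ℝ) → ℝ,
      (∀ s ∈ S, ∀ t : ℝ, 0 < t → s + t • w ∈ S) →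
      (∀ s ∈ S, ∀ t : ℝ, 0 < t → s + t • (-w) ∈ S) → w = 0) := by
  refine ⟨fun v w => ?_, ?_, fun w hw _ => ?_⟩
  · refine IsSeqClosed.isClosed fun t t' ht htt' => ?_
    choose μ hμ hμt using ht
    refine mem_image_sublevel_of_tendsto hΩne hΩcp hα hβ (fun k => (hμ k).1) (fun k => (hμ k).2)
      fun s φ => ?_
    simp only [hμt]
    exact (htt'.mul_const (w s φ)).const_add (v s φ)
  · rintro ⟨v, w, hw, h⟩
    exact hw (direction_eq_zero_of_ray_subset hΩne hΩcp hα hβ h)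
  · exact direction_eq_zero_of_ray_subset hΩne hΩcp hα hβ
      (hw 0 (zero_mem_image_sublevel hΩne hc))

end
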